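/- arXiv:1706.03383 — 2 statements merged into one kernel-verified Lean document; each statement's English description precedes it below -/
import Mathlib

section
/- For any prime power q, integers 1 ≤ ℓ ≤ q and L > ℓ, real 0 ≤ α ≤ 1, any rate 0 ≤ ρ < (1/log q)·[(1-α)·log(q/ℓ) - H₂(α) - H₂(ℓ/q)·q/log_q(L+1)], and sufficiently large n, a uniformly random linear code C : F_q^{⌊ρn⌋} → F_q^n is (α, ℓ, L)-list recoverable with probability at least 1 - 2^{-Ω(n)}. -/
/-- The binary entropy function (logarithms base 2). -/
noncomputable def binEnt (x : ℝ) : ℝ :=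
  x * Real.logb 2 (1 / x) + (1 - x) * Real.logb 2 (1 / (1 - x))

/-- The fraction of coordinates `i` with `c i ∉ S i`. -/
noncomputable def listDist {ι A : Type*} [Fintype ι] [DecidableEq A]
    (c : ι → A) (S : ι → Finset A) : ℝ :=
  ((Finset.univ.filter fun i => c i ∉ S i).card : ℝ) / Fintype.card ι

/-- A code `C` is `(α, ℓ, L)`-list recoverable. -/
def ListRecoverable {M ι A : Type*} [Fintype ι] [DecidableEq A]
    (C : M → ι → A) (α : ℝ) (ℓ L : ℕ) : Prop :=
  ∀ S : ι → Finset A, (∀ i, (S i).card ≤ ℓ) →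
    Nat.card {x : M | listDist (C x) S ≤ α} ≤ L

open Finset

/-- Preimages of a finite set under a surjective homomorphism of finite groups. -/
lemma fiber_count {A B : Type*} [AddCommGroup A] [AddCommGroup B] [Fintype A] [Fintype B]
    [DecidableEq B] (φ : A →+ B) (hφ : Function.Surjective φ) (T : Finset B) :
    #{a | φ a ∈ T} * Fintype.card B = #T * Fintype.card A := by
  have hf : ∀ b : B, #{a | φ a = b} = #{a | φ a = 0} := fun b =>
    AddMonoidHom.card_fiber_eq_of_mem_range φ (hφ b) (hφ 0)
  have h1 : #{a | φ a ∈ T} = #T * #{a | φ a = 0} := by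
    rw [Finset.card_eq_sum_card_fiberwise (f := φ) (t := T) (by intro a ha; simpa using ha)]
    rw [Finset.sum_const_nat]
    intro b hb
    rw [← hf b]
    congr 1
    ext a
    simp only [mem_filter, mem_univ, true_and]
    constructor
    · rintro ⟨_, h⟩; exact h
    · rintro rfl; exact ⟨hb, rfl⟩
  have h2 : Fintype.card A = Fintype.card B * #{a | φ a = 0} := by
    rw [← Finset.card_univ, Finset.card_eq_sum_card_fiberwise (f := φ) (t := univ) (by simp)]
    rw [Finset.sum_const_nat (m := #{a | φ a = 0}), Finset.card_univ]
    intro b _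
    exact hf b
  rw [h1, h2]; ring

/-- The matrices sending given linearly independent vectors into a set. -/
lemma matrix_count {F : Type*} [Field F] [Fintype F] [DecidableEq F] {n k m : ℕ}
    (x : Fin m → Fin k → F) (hx : LinearIndependent F x) (V : Finset (Fin n → F)) :
    #{G : Matrix (Fin n) (Fin k) F | ∀ j, G.mulVec (x j) ∈ V} * Fintype.card F ^ (n * m) =
      #V ^ m * Fintype.card (Matrix (Fin n) (Fin k) F) := by
  let φ : Matrix (Fin n) (Fin k) F →+ (Fin m → Fin n → F) :=
    { toFun := fun G j => G.mulVec (x j)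
      map_zero' := by ext; simp
      map_add' := by intro a b; ext; simp [Matrix.add_mulVec] }
  have hφ : Function.Surjective φ := by
    intro y
    obtain ⟨g, hg⟩ := LinearMap.exists_leftInverse_of_injective
      (Fintype.linearCombination F x) (by
        rw [LinearMap.ker_eq_bot]
        exact hx.fintypeLinearCombination_injective)
    refine ⟨LinearMap.toMatrix' ((Fintype.linearCombination F y).comp g), ?_⟩
    funext j
    change Matrix.mulVec _ (x j) = y j
    rw [LinearMap.toMatrix'_mulVec]
    have h1 : x j = Fintype.linearCombination F x (Pi.single j 1) := by
      simp [Fintype.linearCombination_apply_single]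
    have h2 := congrArg (fun f => f (Pi.single j (1 : F))) hg
    simp only [LinearMap.comp_apply, LinearMap.id_apply] at h2
    rw [LinearMap.comp_apply, h1, h2]
    simp [Fintype.linearCombination_apply_single]
  have := fiber_count φ hφ (Fintype.piFinset fun _ => V)
  simp only [Fintype.mem_piFinset, Fintype.card_piFinset, Finset.prod_const, Finset.card_univ,
    Fintype.card_fin, Fintype.card_pi] at this
  rw [pow_mul]
  exact this

/-- A large set of vectors contains many independent ones. -/
lemma exists_indep {F : Type*} [Field F] [Fintype F] {k m N : ℕ}
    (X : Set (Fin k → F)) (hX : N < Nat.card X)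
    (hm : m ≤ Nat.clog (Fintype.card F) (N + 1)) :
    ∃ x : Fin m → Fin k → F, LinearIndependent F x ∧ ∀ j, x j ∈ X := by
  obtain ⟨b, hbX, hspan, hb⟩ := exists_linearIndependent F X
  have hfin : Finite b := Set.toFinite b
  have : Fintype b := Fintype.ofFinite b
  have h1 : Nat.card X ≤ Nat.card (Submodule.span F X) :=
    Nat.card_mono (Set.toFinite _) Submodule.subset_span
  have h2 : Nat.card (Submodule.span F X) = Fintype.card F ^ Fintype.card b := by
    rw [← hspan, Module.natCard_eq_pow_finrank (K := F), Nat.card_eq_fintype_card]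
    congr 1
    have := finrank_span_eq_card hb
    rw [Subtype.range_coe] at this
    exact this
  have h3 : m ≤ Fintype.card b := by
    refine hm.trans (Nat.clog_le_of_le_pow ?_)
    omega
  obtain ⟨e⟩ : Nonempty (Fin m ↪ b) := by
    rw [Function.Embedding.nonempty_iff_card_le]; simpa using h3
  exact ⟨fun j => (e j : Fin k → F), hb.comp e e.injective, fun j => hbX (e j).2⟩

/-- Chernoff-type bound for the size of the ball around a product set. -/
lemma ball_count {F : Type*} [Field F] [Fintype F] [DecidableEq F] {n ℓ : ℕ} (hn : 0 < n)
    (S : Fin n → Finset F) (hS : ∀ i, #(S i) = ℓ) (α s : ℝ) (hs0 : 0 ≤ s) (hs1 : s ≤ 1)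
    (hsα : s = 0 → α = 0) [DecidablePred fun c : Fin n → F => listDist c S ≤ α] :
    (#{c : Fin n → F | listDist c S ≤ α} : ℝ) ≤
      ((ℓ + Fintype.card F * s) * s ^ (-α)) ^ n := by
  have key : ∀ c : Fin n → F, listDist c S ≤ α →
      (1 : ℝ) ≤ (∏ i, if c i ∈ S i then (1 : ℝ) else s) * (s ^ (-α)) ^ n := by
    intro c hc
    have hprod : (∏ i, if c i ∈ S i then (1 : ℝ) else s) = s ^ #{i | c i ∉ S i} := by
      rw [Finset.prod_ite]; simp
    have hd : (#{i | c i ∉ S i} : ℝ) ≤ α * n := by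
      have := hc
      unfold listDist at this
      rw [Fintype.card_fin, div_le_iff₀ (by exact_mod_cast hn)] at this
      exact this
    rw [hprod]
    rcases hs0.eq_or_lt with h | h
    · have hα := hsα h.symm
      rw [hα, zero_mul] at hd
      have : #{i | c i ∉ S i} = 0 := by exact_mod_cast le_antisymm hd (by positivity)
      rw [this, hα]; simp
    · rw [← Real.rpow_natCast, ← Real.rpow_natCast (s ^ (-α)), ← Real.rpow_mul hs0,
        ← Real.rpow_add h]
      exact Real.one_le_rpow_of_pos_of_le_one_of_nonpos h hs1 (by linarith)
  have hT : (0 : ℝ) ≤ (s ^ (-α)) ^ n := pow_nonneg (Real.rpow_nonneg hs0 _) _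
  calc (#{c : Fin n → F | listDist c S ≤ α} : ℝ)
      = ∑ c ∈ {c : Fin n → F | listDist c S ≤ α}, (1 : ℝ) := by simp
    _ ≤ ∑ c ∈ {c : Fin n → F | listDist c S ≤ α},
          (∏ i, if c i ∈ S i then (1 : ℝ) else s) * (s ^ (-α)) ^ n :=
        Finset.sum_le_sum fun c hc => key c (by simpa using hc)
    _ ≤ ∑ c : Fin n → F, (∏ i, if c i ∈ S i then (1 : ℝ) else s) * (s ^ (-α)) ^ n := by
        apply Finset.sum_le_sum_of_subset_of_nonneg (Finset.subset_univ _)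
        intro c _ _
        refine mul_nonneg (Finset.prod_nonneg fun i _ => ?_) hT
        split_ifs <;> linarith
    _ = (∏ i : Fin n, ∑ a : F, if a ∈ S i then (1 : ℝ) else s) * (s ^ (-α)) ^ n := by
        rw [← Finset.sum_mul, Fintype.prod_sum]
    _ ≤ (∏ i : Fin n, (ℓ + Fintype.card F * s)) * (s ^ (-α)) ^ n := by
        refine mul_le_mul_of_nonneg_right (Finset.prod_le_prod ?_ ?_) hT
        · intro i _
          refine Finset.sum_nonneg fun a _ => ?_
          split_ifs <;> linarith
        · intro i _
          rw [← hS i]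
          calc (∑ a : F, if a ∈ S i then (1 : ℝ) else s)
              ≤ ∑ a : F, ((if a ∈ S i then (1 : ℝ) else 0) + s) := by
                refine Finset.sum_le_sum fun a _ => ?_
                split_ifs <;> linarith
            _ = _ := by rw [Finset.sum_add_distrib]; simp
    _ = _ := by rw [Finset.prod_const, Finset.card_univ, Fintype.card_fin, mul_pow]

/-- Binomial coefficients are bounded by the entropy. -/
lemma choose_entropy {q ℓ : ℕ} (h1 : 1 ≤ ℓ) (h2 : ℓ < q) :
    Real.logb 2 (q.choose ℓ) ≤ binEnt ((ℓ : ℝ) / q) * q := by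
  have hq : (0 : ℝ) < q := by exact_mod_cast (by omega : 0 < q)
  have hl : (0 : ℝ) < ℓ := by exact_mod_cast h1
  have hlq : (ℓ : ℝ) < q := by exact_mod_cast h2
  set p : ℝ := (ℓ : ℝ) / q with hp
  have hp0 : 0 < p := by positivity
  have hp1 : 0 < 1 - p := by
    rw [sub_pos, hp, div_lt_one hq]; exact hlq
  have hC : (0 : ℝ) < q.choose ℓ := by exact_mod_cast Nat.choose_pos h2.le
  have hle : p ^ ℓ * (1 - p) ^ (q - ℓ) * (q.choose ℓ) ≤ 1 := by
    have h := add_pow p (1 - p) q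
    rw [add_sub_cancel, one_pow] at h
    refine le_of_le_of_eq ?_ h.symm
    exact Finset.single_le_sum (f := fun i => p ^ i * (1 - p) ^ (q - i) * (q.choose i : ℝ))
      (fun i _ => by positivity) (Finset.mem_range.mpr (by omega : ℓ < q + 1))
  have hlog := Real.logb_le_logb_of_le (b := 2) (by norm_num) (by positivity) hle
  rw [Real.logb_one, Real.logb_mul (by positivity) hC.ne', Real.logb_mul (by positivity)
    (by positivity), Real.logb_pow, Real.logb_pow, Nat.cast_sub h2.le] at hlog
  unfold binEnt
  rw [one_div, one_div, Real.logb_inv, Real.logb_inv]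
  have e1 : p * q = ℓ := by rw [hp]; field_simp
  have e2 : (p * -Real.logb 2 p + (1 - p) * -Real.logb 2 (1 - p)) * q =
    -((p * q) * Real.logb 2 p + (q - p * q) * Real.logb 2 (1 - p)) := by ring
  rw [e2, e1]
  linarith

lemma binEnt_nonneg {x : ℝ} (h0 : 0 ≤ x) (h1 : x ≤ 1) : 0 ≤ binEnt x := by
  unfold binEnt
  rw [one_div, one_div, Real.logb_inv, Real.logb_inv]
  have a := Real.logb_nonpos (b := 2) (by norm_num) h0 h1
  have b := Real.logb_nonpos (b := 2) (x := 1 - x) (by norm_num) (by linarith) (by linarith)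
  nlinarith

lemma card_split {A : Type*} [Fintype A] (P : A → Prop) :
    Nat.card {a // P a} + Nat.card {a // ¬ P a} = Fintype.card A := by
  classical
  rw [← Nat.card_sum, ← Nat.card_eq_fintype_card]
  exact Nat.card_congr (Equiv.sumCompl P)

/-- Union bound. -/
lemma bad_count {F : Type*} [Field F] [Fintype F] [DecidableEq F] {n k m ℓ L : ℕ} (hn : 0 < n)
    (hℓ : ℓ ≤ Fintype.card F) (hm : m ≤ Nat.clog (Fintype.card F) (L + 1))
    (α s : ℝ) (hs0 : 0 ≤ s) (hs1 : s ≤ 1) (hsα : s = 0 → α = 0) :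
    (Nat.card {G : Matrix (Fin n) (Fin k) F //
        ¬ ListRecoverable (fun x : Fin k → F => G.mulVec x) α ℓ L} : ℝ)
        * (Fintype.card F : ℝ) ^ (n * m) ≤
      ((Fintype.card F).choose ℓ : ℝ) ^ n * (Fintype.card F : ℝ) ^ (k * m) *
        ((((ℓ + Fintype.card F * s) * s ^ (-α)) ^ n) ^ m *
        Fintype.card (Matrix (Fin n) (Fin k) F)) := by
  classical
  let 𝒮 : Finset (Fin n → Finset F) := Fintype.piFinset fun _ => powersetCard ℓ univ
  let E : (Fin n → Finset F) → Finset (Fin n → F) := fun S => {c | listDist c S ≤ α}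
  let 𝒳 : Finset (Fin m → Fin k → F) := {x | LinearIndependent F x}
  let Bd : Finset (Matrix (Fin n) (Fin k) F) :=
    {G | ¬ ListRecoverable (fun x : Fin k → F => G.mulVec x) α ℓ L}
  have hBd : Nat.card {G : Matrix (Fin n) (Fin k) F //
        ¬ ListRecoverable (fun x : Fin k → F => G.mulVec x) α ℓ L} = #Bd := by
    rw [Nat.card_eq_fintype_card, Fintype.card_subtype]
  have hsub : Bd ⊆ (𝒮 ×ˢ 𝒳).biUnion fun P =>
      {G : Matrix (Fin n) (Fin k) F | ∀ j, G.mulVec (P.2 j) ∈ E P.1} := by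
    intro G hG
    replace hG := (Finset.mem_filter.mp hG).2
    unfold ListRecoverable at hG
    push Not at hG
    obtain ⟨S, hS, hc⟩ := hG
    obtain ⟨x, hx, hxX⟩ := exists_indep _ hc hm
    have hT : ∀ i, ∃ T : Finset F, S i ⊆ T ∧ #T = ℓ := fun i => by
      obtain ⟨T, h, _, h'⟩ := Finset.exists_subsuperset_card_eq (Finset.subset_univ (S i)) (hS i)
        (by simpa using hℓ)
      exact ⟨T, h, h'⟩
    choose T hST hTc using hT
    refine Finset.mem_biUnion.mpr ⟨(T, x), ?_, ?_⟩
    · simp [𝒮, 𝒳, hx, hTc, mem_powersetCard]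
    · simp only [E, mem_filter, mem_univ, true_and]
      intro j
      refine le_trans ?_ (hxX j)
      unfold listDist
      gcongr
      exact hST _
  set q := Fintype.card F
  have hE : ∀ S ∈ 𝒮, (#(E S) : ℝ) ≤ ((ℓ + q * s) * s ^ (-α)) ^ n := by
    intro S hS
    refine ball_count hn S ?_ α s hs0 hs1 hsα
    intro i
    have := Fintype.mem_piFinset.mp hS i
    exact (mem_powersetCard.mp this).2
  have hX : (#𝒳 : ℝ) ≤ (q : ℝ) ^ (k * m) := by
    have : #𝒳 ≤ q ^ (k * m) := by
      refine (Finset.card_le_univ _).trans ?_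
      simp [q, pow_mul]
    exact_mod_cast this
  have hSc : (#𝒮 : ℝ) = (q.choose ℓ : ℝ) ^ n := by
    simp [𝒮, q, Fintype.card_piFinset, card_powersetCard]
  rw [hBd]
  set M : ℝ := (((ℓ + q * s) * s ^ (-α)) ^ n) ^ m * Fintype.card (Matrix (Fin n) (Fin k) F)
  have hM : 0 ≤ M := by
    have := Real.rpow_nonneg hs0 (-α)
    positivity
  have hterm : ∀ P ∈ 𝒮 ×ˢ 𝒳, (#{G : Matrix (Fin n) (Fin k) F | ∀ j, G.mulVec (P.2 j) ∈ E P.1} : ℝ)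
      * (q : ℝ) ^ (n * m) ≤ M := by
    rintro ⟨S, x⟩ hP
    obtain ⟨h1, h2⟩ := Finset.mem_product.mp hP
    have hx : LinearIndependent F x := by simpa [𝒳] using h2
    have := matrix_count x hx (E S)
    have h3 : (#{G : Matrix (Fin n) (Fin k) F | ∀ j, G.mulVec (x j) ∈ E S} : ℝ)
      * (q : ℝ) ^ (n * m) = (#(E S) : ℝ) ^ m * Fintype.card (Matrix (Fin n) (Fin k) F) := by
      exact_mod_cast this
    rw [h3]
    refine mul_le_mul_of_nonneg_right ?_ (Nat.cast_nonneg _)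
    exact pow_le_pow_left₀ (Nat.cast_nonneg _) (hE S h1) m
  calc (#Bd : ℝ) * (q : ℝ) ^ (n * m)
      ≤ (∑ P ∈ 𝒮 ×ˢ 𝒳, (#{G : Matrix (Fin n) (Fin k) F | ∀ j, G.mulVec (P.2 j) ∈ E P.1} : ℝ))
        * (q : ℝ) ^ (n * m) := by
        refine mul_le_mul_of_nonneg_right ?_ (by positivity)
        exact_mod_cast (Finset.card_le_card hsub).trans Finset.card_biUnion_le
    _ ≤ ∑ P ∈ 𝒮 ×ˢ 𝒳, M := by
        rw [Finset.sum_mul]; exact Finset.sum_le_sum hterm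
    _ = (#𝒮 : ℝ) * #𝒳 * M := by
        rw [Finset.sum_const, Finset.card_product]; simp
    _ ≤ _ := by
        rw [hSc]; gcongr

set_option maxHeartbeats 2000000 in
/-- A uniformly random linear code of rate below the stated threshold is
`(α, ℓ, L)`-list recoverable with probability `1 - 2^{-Ω(n)}`. -/
theorem random_linear_list_recoverable (F : Type*) [Field F] [Fintype F] [DecidableEq F]
    (q : ℕ) (hq : Fintype.card F = q) (ℓ L : ℕ) (hℓ1 : 1 ≤ ℓ) (hℓq : ℓ ≤ q) (hL : ℓ < L)
    (α ρ : ℝ) (hα0 : 0 ≤ α) (hα1 : α ≤ 1) (hρ0 : 0 ≤ ρ)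
    (hρ : ρ < (1 / Real.logb 2 q) *
      ((1 - α) * Real.logb 2 ((q : ℝ) / ℓ) - binEnt α -
        binEnt ((ℓ : ℝ) / q) * q / Real.logb q (L + 1))) :
    ∃ c : ℝ, 0 < c ∧ ∃ N : ℕ, ∀ n : ℕ, N ≤ n →
      (1 : ℝ) - 2 ^ (-(c * n)) ≤
        (Nat.card {G : Matrix (Fin n) (Fin ⌊ρ * n⌋₊) F //
            ListRecoverable (fun x : Fin ⌊ρ * n⌋₊ → F => G.mulVec x) α ℓ L} : ℝ)
          / (Nat.card (Matrix (Fin n) (Fin ⌊ρ * n⌋₊) F) : ℝ) := by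
  have hq2 : 2 ≤ q := by rw [← hq]; exact Fintype.one_lt_card
  have hq0 : (0 : ℝ) < q := by exact_mod_cast (by omega : 0 < q)
  have hq1 : (1 : ℝ) < q := by exact_mod_cast (by omega : 1 < q)
  have hl0 : (0 : ℝ) < ℓ := by exact_mod_cast hℓ1
  have hlq : (ℓ : ℝ) ≤ q := by exact_mod_cast hℓq
  have hlogq : 0 < Real.logb 2 q := Real.logb_pos (by norm_num) hq1
  have hlam : 0 < Real.logb q (L + 1) := Real.logb_pos hq1 (by
    have : (0 : ℝ) < L := by exact_mod_cast (by omega : 0 < L)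
    linarith)
  set p : ℝ := (ℓ : ℝ) / q with hp
  have hp0 : 0 < p := by positivity
  have hp1 : p ≤ 1 := by rw [hp, div_le_one hq0]; exact hlq
  have hqp : q * p = ℓ := by rw [hp]; field_simp
  have hpinv : (q : ℝ) / ℓ = p⁻¹ := by rw [hp, inv_div]
  rw [hpinv, Real.logb_inv] at hρ
  have hHp : 0 ≤ binEnt p := binEnt_nonneg hp0.le hp1
  have hHa : 0 ≤ binEnt α := binEnt_nonneg hα0 hα1
  set W : ℝ := binEnt p * q / Real.logb q (L + 1) with hW
  have hW0 : 0 ≤ W := by positivity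
  have hmain : ρ * Real.logb 2 q < (1 - α) * -Real.logb 2 p - binEnt α - W := by
    rw [one_div, inv_mul_eq_div, lt_div_iff₀ hlogq] at hρ
    exact hρ
  have hpos : 0 < (1 - α) * -Real.logb 2 p - binEnt α - W :=
    lt_of_le_of_lt (by positivity) hmain
  have hα1' : 0 < 1 - α := by
    rcases hα1.eq_or_lt with h | h
    · rw [h] at hpos hHa; linarith
    · linarith
  have hlp : p ≠ 1 := by
    intro h; rw [h, Real.logb_one] at hpos; linarith
  have hℓlt : ℓ < q := by
    refine lt_of_le_of_ne hℓq ?_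
    intro h
    apply hlp
    rw [hp, h, div_self hq0.ne']
  have hpα : p ≤ 1 - α := by
    by_contra hcon
    push Not at hcon
    have h1 : Real.logb 2 (1 - α) ≤ Real.logb 2 p :=
      Real.logb_le_logb_of_le (by norm_num) hα1' hcon.le
    have h2 : (1 - α) * -Real.logb 2 (1 - α) ≤ binEnt α := by
      unfold binEnt
      rw [one_div, one_div, Real.logb_inv, Real.logb_inv]
      have a := Real.logb_nonpos (b := 2) (by norm_num) hα0 hα1
      nlinarith
    nlinarith
  -- the tilting parameter
  set s : ℝ := α * p / (1 - α) with hs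
  have hs0 : 0 ≤ s := by positivity
  have hs1 : s ≤ 1 := by
    rw [hs, div_le_one hα1']; nlinarith
  have hsα : s = 0 → α = 0 := by
    intro h
    rw [hs, div_eq_zero_iff] at h
    rcases h with h | h
    · exact (mul_eq_zero.mp h).resolve_right hp0.ne'
    · linarith
  have hsT : 0 < s ^ (-α) := by
    rcases hs0.eq_or_lt with h | h
    · rw [hsα h.symm]; simp
    · exact Real.rpow_pos_of_pos h _
  set B : ℝ := (p + s) * s ^ (-α) with hB
  have hB0 : 0 < B := by positivity
  have hBlog : Real.logb 2 B = binEnt α + (1 - α) * Real.logb 2 p := by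
    have hps : p + s = p / (1 - α) := by rw [hs]; field_simp; ring
    rw [hB, Real.logb_mul (by positivity) hsT.ne', hps, Real.logb_div hp0.ne' hα1'.ne']
    unfold binEnt
    rw [one_div, one_div, Real.logb_inv, Real.logb_inv]
    rcases hα0.eq_or_lt with h | h
    · rw [← h]; simp
    · have hsp : 0 < s := by positivity
      rw [Real.logb_rpow_eq_mul_logb_of_pos hsp, hs, Real.logb_div (by positivity) hα1'.ne',
        Real.logb_mul h.ne' hp0.ne']
      ring
  set m : ℕ := Nat.clog q (L + 1) with hm
  have hmlam : Real.logb q (L + 1) ≤ m := by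
    rw [Real.logb_le_iff_le_rpow hq1 (by positivity), Real.rpow_natCast]
    exact_mod_cast Nat.le_pow_clog (by omega) (L + 1)
  have hm0 : (0 : ℝ) < m := lt_of_lt_of_le hlam hmlam
  have hC : (0 : ℝ) < q.choose ℓ := by exact_mod_cast Nat.choose_pos hℓq
  have hClog : Real.logb 2 (q.choose ℓ) ≤ m * W := by
    refine (choose_entropy hℓ1 hℓlt).trans ?_
    have : binEnt p * q = Real.logb q (L + 1) * W := by rw [hW]; field_simp
    rw [← hp, this]
    gcongr
  set R : ℝ := q.choose ℓ * (q : ℝ) ^ (ρ * m) * B ^ m with hR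
  have hR0 : 0 < R := by positivity
  have hRlog : Real.logb 2 R < 0 := by
    rw [hR, Real.logb_mul (by positivity) (by positivity), Real.logb_mul hC.ne' (by positivity),
      Real.logb_rpow_eq_mul_logb_of_pos hq0, Real.logb_pow, hBlog]
    nlinarith
  refine ⟨-Real.logb 2 R, by linarith, 1, fun n hn => ?_⟩
  have hn0 : 0 < n := hn
  have hRn : (2 : ℝ) ^ (-(-Real.logb 2 R * n)) = R ^ n := by
    rw [neg_mul, neg_neg, Real.rpow_mul (by norm_num), Real.rpow_logb (by norm_num) (by norm_num)
      hR0, Real.rpow_natCast]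
  rw [hRn]
  set k := ⌊ρ * n⌋₊ with hk
  have hkle : (k : ℝ) ≤ ρ * n := Nat.floor_le (by positivity)
  have hbad := bad_count (F := F) (n := n) (k := k) (m := m) (ℓ := ℓ) (L := L) hn0
    (by rw [hq]; exact hℓq) (by rw [hq]) α s hs0 hs1 hsα
  rw [hq] at hbad
  have hsplit : Nat.card {G : Matrix (Fin n) (Fin k) F //
        ListRecoverable (fun x : Fin k → F => G.mulVec x) α ℓ L} +
      Nat.card {G : Matrix (Fin n) (Fin k) F //
        ¬ ListRecoverable (fun x : Fin k → F => G.mulVec x) α ℓ L} =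
      Fintype.card (Matrix (Fin n) (Fin k) F) := by
    classical
    exact card_split _
  rw [Nat.card_eq_fintype_card (α := Matrix (Fin n) (Fin k) F)]
  have hsplitR : (Nat.card {G : Matrix (Fin n) (Fin k) F //
        ListRecoverable (fun x : Fin k → F => G.mulVec x) α ℓ L} : ℝ) +
      (Nat.card {G : Matrix (Fin n) (Fin k) F //
        ¬ ListRecoverable (fun x : Fin k → F => G.mulVec x) α ℓ L} : ℝ) =
      (Fintype.card (Matrix (Fin n) (Fin k) F) : ℝ) := by exact_mod_cast hsplit
  have hTot : (0 : ℝ) < (Fintype.card (Matrix (Fin n) (Fin k) F) : ℝ) := by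
    exact_mod_cast Fintype.card_pos
  rw [le_div_iff₀ hTot]
  set Tot : ℝ := (Fintype.card (Matrix (Fin n) (Fin k) F) : ℝ)
  set bad : ℝ := (Nat.card {G : Matrix (Fin n) (Fin k) F //
        ¬ ListRecoverable (fun x : Fin k → F => G.mulVec x) α ℓ L} : ℝ)
  have hqB : ((ℓ : ℝ) + q * s) * s ^ (-α) = q * B := by
    rw [hB, ← hqp]; ring
  have hqk : (q : ℝ) ^ (k * m) ≤ ((q : ℝ) ^ (ρ * m)) ^ n := by
    rw [← Real.rpow_natCast, ← Real.rpow_natCast ((q : ℝ) ^ (ρ * m)), ← Real.rpow_mul hq0.le]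
    refine Real.rpow_le_rpow_of_exponent_le hq1.le ?_
    push_cast
    have := mul_le_mul_of_nonneg_right hkle hm0.le
    linarith only [this]
  have hfin : bad ≤ R ^ n * Tot := by
    have hqnm : (0 : ℝ) < (q : ℝ) ^ (n * m) := by positivity
    refine le_of_mul_le_mul_right (hbad.trans ?_) hqnm
    rw [hqB]
    calc (q.choose ℓ : ℝ) ^ n * (q : ℝ) ^ (k * m) * (((q * B) ^ n) ^ m * Tot)
        ≤ (q.choose ℓ : ℝ) ^ n * ((q : ℝ) ^ (ρ * m)) ^ n * (((q * B) ^ n) ^ m * Tot) := by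
          gcongr
      _ = R ^ n * Tot * (q : ℝ) ^ (n * m) := by
          rw [hR]; ring
  linarith
end

section
/- There is an absolute constant c such that for all ρ ∈ [0,1], ε > 0, and positive integer ℓ, if q is a prime power with q ≥ max{(1-ρ-ε)^{-c(1-ρ-ε)/ε}, (ρ+ε)^{-c(ρ+ε)/ε}, ℓ^{c/ε}}, then for sufficiently large n a uniformly random linear code C : F_q^{⌊ρn⌋} → F_q^n is (1-ρ-ε, ℓ, q^{cℓ/ε})-list recoverable with probability at least 1 - 2^{-Ω(n)}. -/
/-- Fibre counting for the evaluation of a matrix at linearly independent vectors. -/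
theorem rlc_fiber_count {F : Type} [Field F] [Fintype F] [DecidableEq F] {n k m : ℕ}
    (x : Fin m → Fin k → F) (hx : LinearIndependent F x) (P : Finset (Fin m → Fin n → F)) :
    (Finset.univ.filter fun G : Matrix (Fin n) (Fin k) F =>
        (fun j => G.mulVec (x j)) ∈ P).card * Fintype.card F ^ (n * m)
      = P.card * Fintype.card F ^ (n * k) := by
  classical
  let φ : Matrix (Fin n) (Fin k) F →+ (Fin m → Fin n → F) :=
    { toFun := fun G j => G.mulVec (x j)
      map_zero' := by ext; simp
      map_add' := by intro A B; ext; simp [Matrix.add_mulVec] }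
  have hsurj : Function.Surjective φ := by
    intro y
    obtain ⟨g, hg⟩ := LinearMap.exists_leftInverse_of_injective
      (Finsupp.linearCombination F x) (LinearMap.ker_eq_bot.2 hx)
    refine ⟨LinearMap.toMatrix' ((Finsupp.linearCombination F y) ∘ₗ g), ?_⟩
    funext j
    change (LinearMap.toMatrix' ((Finsupp.linearCombination F y) ∘ₗ g)).mulVec (x j) = y j
    rw [LinearMap.toMatrix'_mulVec]
    have := LinearMap.congr_fun hg (Finsupp.single j 1)
    simp at this
    simp [this]
  have hfib : ∀ y, (Finset.univ.filter fun G => φ G = y).card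
      = (Finset.univ.filter fun G => φ G = 0).card := fun y =>
    AddMonoidHom.card_fiber_eq_of_mem_range φ (hsurj y) (hsurj 0)
  have hgen : ∀ P : Finset (Fin m → Fin n → F), (Finset.univ.filter fun G => φ G ∈ P).card
      = P.card * (Finset.univ.filter fun G => φ G = 0).card := by
    intro P
    rw [Finset.card_eq_sum_card_fiberwise (f := φ) (t := P) (by intro G hG; simpa using hG)]
    rw [← smul_eq_mul, ← Finset.sum_const]
    refine Finset.sum_congr rfl fun y hy => ?_
    rw [← hfib y]
    congr 1
    ext G
    simp only [Finset.mem_filter, Finset.mem_univ, true_and]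
    constructor
    · rintro ⟨_, h⟩; exact h
    · intro h; exact ⟨h ▸ hy, h⟩
  have h1 := hgen P
  have h2 := hgen Finset.univ
  simp only [Finset.mem_univ, Finset.filter_true, Finset.card_univ] at h2
  have c1 : Fintype.card (Matrix (Fin n) (Fin k) F) = Fintype.card F ^ (n * k) := by
    rw [Fintype.card_congr (Matrix.of (m := Fin n) (n := Fin k) (α := F)).symm]
    simp [Fintype.card_pi, ← pow_mul, mul_comm]
  have c2 : Fintype.card (Fin m → Fin n → F) = Fintype.card F ^ (n * m) := by
    simp [Fintype.card_pi, ← pow_mul]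
  rw [c1, c2] at h2
  change (Finset.univ.filter fun G => φ G ∈ P).card * _ = _
  rw [h1, h2]; ring

theorem rlc_target_count {F : Type} [Field F] [Fintype F] [DecidableEq F] {n m l t : ℕ}
    (s : Fin n → Fin l → F) (T : Fin m → Finset (Fin n)) (hT : ∀ j, (T j).card = t) :
    (Finset.univ.filter fun y : Fin m → Fin n → F =>
        ∀ j, ∀ i ∈ T j, ∃ b, s i b = y j i).card
      ≤ (l ^ t * Fintype.card F ^ (n - t)) ^ m := by
  classical
  have hsub : (Finset.univ.filter fun y : Fin m → Fin n → F =>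
        ∀ j, ∀ i ∈ T j, ∃ b, s i b = y j i) ⊆
      Fintype.piFinset fun j => Fintype.piFinset fun i =>
        if i ∈ T j then Finset.univ.image (s i) else Finset.univ := by
    intro y hy
    simp only [Finset.mem_filter, Finset.mem_univ, true_and] at hy
    simp only [Fintype.mem_piFinset]
    intro j i
    split_ifs with h
    · simpa using hy j i h
    · simp
  refine (Finset.card_le_card hsub).trans ?_
  rw [Fintype.card_piFinset]
  have : ∀ j ∈ (Finset.univ : Finset (Fin m)), (Fintype.piFinset fun i =>
        if i ∈ T j then Finset.univ.image (s i) else Finset.univ).card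
        ≤ l ^ t * Fintype.card F ^ (n - t) := by
    intro j _
    rw [Fintype.card_piFinset]
    calc _ ≤ ∏ i, if i ∈ T j then l else Fintype.card F := by
          refine Finset.prod_le_prod' fun i _ => ?_
          split_ifs
          · exact Finset.card_image_le.trans (by simp)
          · simp
      _ = _ := by
          rw [Finset.prod_ite]
          simp only [Finset.prod_const, Finset.filter_mem_eq_inter, Finset.univ_inter, hT]
          congr 2
          rw [← Finset.compl_filter, Finset.card_compl]
          simp [hT]
  refine (Finset.prod_le_pow_card _ _ _ this).trans (by simp)

/-- The union bound. -/
theorem rlc_union {F : Type} [Field F] [Fintype F] [DecidableEq F] {n k m l t : ℕ}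
    (Bad : Finset (Matrix (Fin n) (Fin k) F))
    (hB : ∀ G ∈ Bad, ∃ (s : Fin n → Fin l → F) (x : Fin m → Fin k → F)
      (T : Fin m → Finset (Fin n)), LinearIndependent F x ∧ (∀ j, (T j).card = t) ∧
        ∀ j, ∀ i ∈ T j, ∃ b, s i b = G.mulVec (x j) i) :
    Bad.card * Fintype.card F ^ (n * m) ≤
      Fintype.card F ^ (n * l) * Fintype.card F ^ (k * m) * n.choose t ^ m *
        ((l ^ t * Fintype.card F ^ (n - t)) ^ m * Fintype.card F ^ (n * k)) := by
  classical
  let I : Finset ((Fin n → Fin l → F) × (Fin m → Fin k → F) × (Fin m → Finset (Fin n))) :=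
    Finset.univ ×ˢ ((Finset.univ.filter fun x => LinearIndependent F x) ×ˢ
      Fintype.piFinset fun _ => Finset.powersetCard t Finset.univ)
  let E : ((Fin n → Fin l → F) × (Fin m → Fin k → F) × (Fin m → Finset (Fin n))) →
      Finset (Matrix (Fin n) (Fin k) F) := fun z =>
    Finset.univ.filter fun G : Matrix (Fin n) (Fin k) F =>
        (fun j => G.mulVec (z.2.1 j)) ∈ (Finset.univ.filter fun y : Fin m → Fin n → F =>
        ∀ j, ∀ i ∈ z.2.2 j, ∃ b, z.1 i b = y j i)
  have hsub : Bad ⊆ I.biUnion E := by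
    intro G hG
    obtain ⟨s, x, T, hx, hT, h⟩ := hB G hG
    refine Finset.mem_biUnion.2 ⟨(s, x, T), ?_, ?_⟩
    · simp [I, hx, Fintype.mem_piFinset, Finset.mem_powersetCard, hT]
    · simpa [E] using h
  have hI : I.card ≤ Fintype.card F ^ (n * l) * Fintype.card F ^ (k * m) * n.choose t ^ m := by
    simp only [I, Finset.card_product, Fintype.card_piFinset, Finset.card_powersetCard,
      Finset.card_univ, Finset.prod_const, Fintype.card_fin]
    rw [mul_assoc]
    refine Nat.mul_le_mul (le_of_eq ?_) (Nat.mul_le_mul ?_ le_rfl)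
    · simp [Fintype.card_pi, ← pow_mul, mul_comm]
    · refine (Finset.card_filter_le _ _).trans (le_of_eq ?_)
      simp [Fintype.card_pi, ← pow_mul]
  calc Bad.card * Fintype.card F ^ (n * m)
      ≤ (∑ z ∈ I, (E z).card) * Fintype.card F ^ (n * m) :=
        Nat.mul_le_mul_right _ ((Finset.card_le_card hsub).trans Finset.card_biUnion_le)
    _ = ∑ z ∈ I, (E z).card * Fintype.card F ^ (n * m) := Finset.sum_mul ..
    _ ≤ ∑ z ∈ I, ((l ^ t * Fintype.card F ^ (n - t)) ^ m * Fintype.card F ^ (n * k)) := by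
        refine Finset.sum_le_sum fun z hz => ?_
        simp only [I, Finset.mem_product, Finset.mem_univ, true_and, Finset.mem_filter,
          Fintype.mem_piFinset, Finset.mem_powersetCard, Finset.subset_univ] at hz
        rw [rlc_fiber_count z.2.1 hz.1]
        exact Nat.mul_le_mul_right _ (rlc_target_count z.1 z.2.2 hz.2)
    _ = I.card * _ := by rw [Finset.sum_const, smul_eq_mul]
    _ ≤ _ := Nat.mul_le_mul_right _ hI

/-- Logarithmic estimate for a single message. -/
theorem rlc_log_bound (ρ ε q : ℝ) (l n k a : ℕ) (hρ : 0 ≤ ρ) (hε : 0 < ε)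
    (hα : 0 ≤ 1 - ρ - ε) (hl : 1 ≤ l) (hq : 1 < q)
    (h1 : (1 - ρ - ε) ^ (-(6 * (1 - ρ - ε) / ε)) ≤ q)
    (h2 : (ρ + ε) ^ (-(6 * (ρ + ε) / ε)) ≤ q)
    (h3 : (l : ℝ) ^ (6 / ε) ≤ q)
    (hk : (k : ℝ) ≤ ρ * n) (ha : (a : ℝ) ≤ (1 - ρ - ε) * n) (han : a ≤ n) :
    q ^ k * (n.choose (n - a) : ℝ) * ((l : ℝ) ^ (n - a) * q ^ a)
      ≤ Real.exp (Real.log q * n * (1 - ε / 2)) := by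
  have hq0 : 0 < q := by linarith
  set Q := Real.log q with hQ
  have hQ0 : 0 < Q := Real.log_pos hq
  have hl0 : (0 : ℝ) < l := by exact_mod_cast hl
  have hβ : 0 < ρ + ε := by linarith
  set α := 1 - ρ - ε with hαd
  set β := ρ + ε with hβd
  have hαβ : α + β = 1 := by simp [hαd, hβd]
  have g1 : -(α * Real.log α) ≤ ε * Q / 6 := by
    rcases hα.eq_or_lt with h | h
    · rw [← h]; simp; positivity
    · have := Real.log_le_log (Real.rpow_pos_of_pos h _) h1
      rw [Real.log_rpow h] at this
      have e : -(α * Real.log α) = ε / 6 * (-(6 * α / ε) * Real.log α) := by field_simp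
      rw [e]
      nlinarith
  have g2 : -(β * Real.log β) ≤ ε * Q / 6 := by
    have := Real.log_le_log (Real.rpow_pos_of_pos hβ _) h2
    rw [Real.log_rpow hβ] at this
    have e : -(β * Real.log β) = ε / 6 * (-(6 * β / ε) * Real.log β) := by field_simp
    rw [e]
    nlinarith
  have g3 : Real.log l ≤ ε * Q / 6 := by
    have := Real.log_le_log (Real.rpow_pos_of_pos hl0 _) h3
    rw [Real.log_rpow hl0] at this
    have e : Real.log l = ε / 6 * (6 / ε * Real.log l) := by field_simp
    rw [e]
    nlinarith
  have hlα : Real.log α ≤ 0 := Real.log_nonpos hα (by linarith)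
  have hlβ : Real.log β ≤ 0 := Real.log_nonpos hβ.le (by linarith)
  have hll : 0 ≤ Real.log l := Real.log_nonneg (by exact_mod_cast hl)
  have hεβ : ε ≤ β := by linarith
  have hε1 : ε ≤ 1 := by linarith
  have g2' : -Real.log β ≤ Q / 6 := by
    have : β * (-Real.log β) ≤ β * (Q / 6) := by nlinarith
    exact le_of_mul_le_mul_left this hβ
  -- binomial bound
  have hC0 : (0 : ℝ) < n.choose (n - a) := by
    exact_mod_cast Nat.choose_pos (Nat.sub_le _ _)
  have hpa : 0 < α ^ a := by
    rcases hα.eq_or_lt with h | h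
    · have : (a : ℝ) ≤ 0 := by rw [← h] at ha; simpa using ha
      have : a = 0 := by exact_mod_cast le_antisymm this (Nat.cast_nonneg a)
      simp [this]
    · positivity
  have hbin : (n.choose (n - a) : ℝ) * (β ^ (n - a) * α ^ a) ≤ 1 := by
    have hs := add_pow β α n
    rw [add_comm β α, hαβ, one_pow] at hs
    rw [hs]
    have := Finset.single_le_sum (s := Finset.range (n + 1))
      (f := fun m => β ^ m * α ^ (n - m) * (n.choose m : ℝ))
      (fun i _ => by positivity) (a := n - a) (by simp)
    simp only [Nat.sub_sub_self han] at this
    linarith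
  have hlogC : Real.log (n.choose (n - a)) ≤ -(a * Real.log α) - ((n - a : ℕ) : ℝ) * Real.log β := by
    have hb : 0 < β ^ (n - a) := by positivity
    have := Real.log_le_log (by positivity) hbin
    rw [Real.log_one, Real.log_mul hC0.ne' (by positivity), Real.log_mul hb.ne' hpa.ne',
      Real.log_pow, Real.log_pow] at this
    linarith
  rw [← Real.log_le_iff_le_exp (by positivity)]
  rw [Real.log_mul (by positivity) (by positivity), Real.log_mul (by positivity) hC0.ne',
    Real.log_mul (by positivity) (by positivity), Real.log_pow, Real.log_pow, Real.log_pow, ← hQ]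
  have ht : ((n - a : ℕ) : ℝ) = n - a := by exact Nat.cast_sub han
  rw [ht] at hlogC ⊢
  have hn0 : (0 : ℝ) ≤ n := Nat.cast_nonneg n
  have e1 : (k : ℝ) * Q ≤ ρ * n * Q := mul_le_mul_of_nonneg_right hk hQ0.le
  have e2 : -(a * Real.log α) ≤ n * (ε * Q / 6) := by
    have u1 : (a : ℝ) * (-Real.log α) ≤ α * n * (-Real.log α) :=
      mul_le_mul_of_nonneg_right ha (by linarith)
    have u2 := mul_le_mul_of_nonneg_left g1 hn0
    linarith
  have hbr : Real.log l - Real.log β - Q ≤ 0 := by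
    have : ε * Q ≤ 1 * Q := mul_le_mul_of_nonneg_right hε1 hQ0.le
    linarith
  have hta : β * n ≤ (n : ℝ) - a := by
    have : (α + β) * n = n := by rw [hαβ, one_mul]
    linarith
  have e3 : ((n : ℝ) - a) * (Real.log l - Real.log β - Q)
      ≤ β * n * (Real.log l - Real.log β - Q) := mul_le_mul_of_nonpos_right hta hbr
  have e4 : β * n * Real.log l ≤ n * (ε * Q / 6) := by
    have u1 : β * Real.log l ≤ 1 * Real.log l :=
      mul_le_mul_of_nonneg_right (by linarith) hll
    have u2 : n * (β * Real.log l) ≤ n * (ε * Q / 6) :=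
      mul_le_mul_of_nonneg_left (by linarith) hn0
    linarith
  have e5 : n * (-(β * Real.log β)) ≤ n * (ε * Q / 6) := mul_le_mul_of_nonneg_left g2 hn0
  have e6 : β * n * Q = ρ * n * Q + ε * n * Q := by rw [hβd]; ring
  linarith

/-- The structure of a bad generator matrix. -/
theorem rlc_bad {F : Type} [Field F] [Fintype F] [DecidableEq F] {n k m l a : ℕ} (α r : ℝ)
    (hn : 0 < n) (hl : 1 ≤ l) (ha : a = ⌊α * n⌋₊) (hm : m = ⌈r⌉₊)
    (G : Matrix (Fin n) (Fin k) F) (S : Fin n → Finset F) (hS : ∀ i, (S i).card ≤ l)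
    (hbig : (Fintype.card F : ℝ) ^ r <
      (Nat.card {x : Fin k → F | listDist (G.mulVec x) S ≤ α} : ℝ)) :
    ∃ (s : Fin n → Fin l → F) (x : Fin m → Fin k → F)
      (T : Fin m → Finset (Fin n)), LinearIndependent F x ∧ (∀ j, (T j).card = n - a) ∧
        ∀ j, ∀ i ∈ T j, ∃ b, s i b = G.mulVec (x j) i := by
  classical
  set V : Set (Fin k → F) := {x : Fin k → F | listDist (G.mulVec x) S ≤ α} with hV
  have hs : ∀ i, ∃ s : Fin l → F, ∀ c ∈ S i, ∃ b, s b = c := by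
    intro i
    let e := (S i).equivFin
    refine ⟨fun b => if h : b.1 < (S i).card then (e.symm ⟨b.1, h⟩ : F) else 0, fun c hc => ?_⟩
    refine ⟨⟨(e ⟨c, hc⟩).1, (e ⟨c, hc⟩).2.trans_le (hS i)⟩, ?_⟩
    simp
  choose s hs using hs
  obtain ⟨f, hfV, -, hfi⟩ := Submodule.exists_fun_fin_finrank_span_eq F V
  have hcard : Nat.card V ≤ Fintype.card F ^ Module.finrank F (Submodule.span F V) := by
    rw [← Module.card_eq_pow_finrank (K := F) (V := Submodule.span F V),
      ← Nat.card_eq_fintype_card]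
    exact Nat.card_mono (Set.toFinite _) Submodule.subset_span
  have hq : (1 : ℝ) < Fintype.card F := by exact_mod_cast Fintype.one_lt_card
  have hd : m ≤ Module.finrank F (Submodule.span F V) := by
    rw [hm]
    refine Nat.ceil_le.2 ?_
    have h1 : (Fintype.card F : ℝ) ^ r <
        (Fintype.card F : ℝ) ^ ((Module.finrank F (Submodule.span F V) : ℕ) : ℝ) := by
      rw [Real.rpow_natCast]
      exact hbig.trans_le (by exact_mod_cast hcard)
    exact ((Real.rpow_lt_rpow_left_iff hq).1 h1).le
  have hT : ∀ x ∈ V, ∃ T : Finset (Fin n), T.card = n - a ∧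
      ∀ i ∈ T, G.mulVec x i ∈ S i := by
    intro x hx
    have hx' : ((Finset.univ.filter fun i => G.mulVec x i ∉ S i).card : ℝ) / Fintype.card (Fin n)
        ≤ α := hx
    rw [Fintype.card_fin, div_le_iff₀ (by exact_mod_cast hn)] at hx'
    have h2 := Nat.le_floor hx'
    rw [← ha] at h2
    have h3 := Finset.card_filter_add_card_filter_not (s := (Finset.univ : Finset (Fin n)))
      (fun i => G.mulVec x i ∈ S i)
    rw [Finset.card_univ, Fintype.card_fin] at h3
    obtain ⟨T, hTs, hTc⟩ := Finset.exists_subset_card_eq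
      (s := Finset.univ.filter fun i => G.mulVec x i ∈ S i) (n := n - a) (by omega)
    exact ⟨T, hTc, fun i hi => (Finset.mem_filter.1 (hTs hi)).2⟩
  choose T hTc hTm using hT
  refine ⟨s, fun j => f (Fin.castLE hd j), fun j => T _ (hfV (Fin.castLE hd j)),
    hfi.comp _ (Fin.castLE_injective hd), fun j => hTc _ _, fun j i hi => ?_⟩
  exact hs i _ (hTm _ _ i hi)

/-- Random linear codes over large enough alphabets achieve list-recovery capacity:
there is a constant `c` so that for all `ρ, ε, ℓ` and prime powers `q` large enough,
a uniformly random linear code of rate `ρ` is `(1-ρ-ε, ℓ, q^{cℓ/ε})`-list recoverable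
with probability `1 - 2^{-Ω(n)}`.  (Prime powers `q` are captured by letting `q` be
the cardinality of a finite field `F`.) -/
theorem random_linear_list_recovery_capacity :
    ∃ c : ℝ, 0 < c ∧
      ∀ (ρ ε : ℝ) (ℓ : ℕ), ρ ∈ Set.Icc (0:ℝ) 1 → 0 < ε → 1 ≤ ℓ →
      ∀ (F : Type) [Field F] [Fintype F] [DecidableEq F] (q : ℕ), Fintype.card F = q →
        (q : ℝ) ≥ max (max ((1 - ρ - ε) ^ (-(c * (1 - ρ - ε) / ε)))
                          ((ρ + ε) ^ (-(c * (ρ + ε) / ε))))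
                      ((ℓ : ℝ) ^ (c / ε)) →
      ∃ c' : ℝ, 0 < c' ∧ ∃ N : ℕ, ∀ n : ℕ, N ≤ n →
        (1 : ℝ) - 2 ^ (-(c' * n)) ≤
          (Nat.card {G : Matrix (Fin n) (Fin ⌊ρ * n⌋₊) F //
              ∀ S : Fin n → Finset F, (∀ i, (S i).card ≤ ℓ) →
                (Nat.card {x : Fin ⌊ρ * n⌋₊ → F |
                    listDist (G.mulVec x) S ≤ 1 - ρ - ε} : ℝ) ≤
                  (q : ℝ) ^ (c * ℓ / ε)} : ℝ)
            / (Nat.card (Matrix (Fin n) (Fin ⌊ρ * n⌋₊) F) : ℝ) := by  classical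
  refine ⟨6, by norm_num, ?_⟩
  intro ρ ε ℓ hρ hε hℓ F _ _ _ q hFq hmax
  refine ⟨1, one_pos, 1, fun n hn => ?_⟩
  have hn0 : 0 < n := hn
  have hq1 : (1 : ℝ) < q := by rw [← hFq]; exact_mod_cast Fintype.one_lt_card
  have hq2 : (2 : ℝ) ≤ q := by
    rw [← hFq]; exact_mod_cast (Fintype.one_lt_card : 1 < Fintype.card F)
  have hq0 : (0 : ℝ) < q := by linarith
  obtain ⟨hm12, h3⟩ := max_le_iff.1 hmax
  obtain ⟨h1, h2⟩ := max_le_iff.1 hm12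
  generalize hk : ⌊ρ * n⌋₊ = k
  have hkn : (k : ℝ) ≤ ρ * n := by
    rw [← hk]; exact Nat.floor_le (mul_nonneg hρ.1 (Nat.cast_nonneg n))
  let good : Matrix (Fin n) (Fin k) F → Prop := fun G =>
    ∀ S : Fin n → Finset F, (∀ i, (S i).card ≤ ℓ) →
      (Nat.card {x : Fin k → F | listDist (G.mulVec x) S ≤ 1 - ρ - ε} : ℝ) ≤
        (q : ℝ) ^ (6 * ℓ / ε)
  change (1 : ℝ) - 2 ^ (-(1 * n : ℝ)) ≤ (Nat.card {G // good G} : ℝ) /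
    (Nat.card (Matrix (Fin n) (Fin k) F) : ℝ)
  have cM : Nat.card (Matrix (Fin n) (Fin k) F) = q ^ (n * k) := by
    rw [Nat.card_congr (Matrix.of (m := Fin n) (n := Fin k) (α := F)).symm]
    simp [Fintype.card_pi, ← pow_mul, mul_comm, hFq]
  let Bad : Finset (Matrix (Fin n) (Fin k) F) := Finset.univ.filter fun G => ¬ good G
  have hsum : Nat.card {G // good G} + Bad.card = q ^ (n * k) := by
    rw [← cM, Nat.card_eq_fintype_card, Nat.card_eq_fintype_card, Fintype.card_subtype,
      ← Finset.card_univ]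
    exact Finset.card_filter_add_card_filter_not _
  have key : (Bad.card : ℝ) ≤ (2 : ℝ) ^ (-(1 * n : ℝ)) * (q : ℝ) ^ (n * k) := by
    rcases lt_or_ge (1 - ρ - ε) 0 with hα | hα
    · have : Bad = ∅ := by
        refine Finset.filter_eq_empty_iff.2 fun G _ => not_not.2 ?_
        intro S _
        have : {x : Fin k → F | listDist (G.mulVec x) S ≤ 1 - ρ - ε} = ∅ := by
          refine Set.eq_empty_of_forall_notMem fun x hx => ?_
          have hx' : listDist (G.mulVec x) S ≤ 1 - ρ - ε := hx
          have : 0 ≤ listDist (G.mulVec x) S := by unfold listDist; positivity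
          linarith
        rw [this]
        simp
        positivity
      rw [this, Finset.card_empty, Nat.cast_zero]
      positivity
    · set a := ⌊(1 - ρ - ε) * n⌋₊ with ha
      set m := ⌈6 * (ℓ : ℝ) / ε⌉₊ with hm
      have han' : (a : ℝ) ≤ (1 - ρ - ε) * n :=
        Nat.floor_le (mul_nonneg hα (Nat.cast_nonneg n))
      have han : a ≤ n := by
        have : (a : ℝ) ≤ n := by
          refine han'.trans ?_
          have : (0 : ℝ) ≤ n := Nat.cast_nonneg n
          nlinarith [hρ.1]
        exact_mod_cast this
      have hU := rlc_union (F := F) (n := n) (k := k) (m := m) (l := ℓ) (t := n - a) Bad (by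
        intro G hG
        have hG' : ¬ good G := (Finset.mem_filter.1 hG).2
        simp only [good, not_forall, not_le] at hG'
        obtain ⟨S, hS, hb⟩ := hG'
        rw [← hFq] at hb
        exact rlc_bad (1 - ρ - ε) (6 * ℓ / ε) hn0 hℓ ha hm G S hS hb)
      rw [hFq, Nat.sub_sub_self han] at hU
      have hU' : (Bad.card : ℝ) * (q : ℝ) ^ (n * m) ≤
          (q : ℝ) ^ (n * ℓ) * (q : ℝ) ^ (k * m) * (n.choose (n - a) : ℝ) ^ m *
          (((ℓ : ℝ) ^ (n - a) * (q : ℝ) ^ a) ^ m * (q : ℝ) ^ (n * k)) := by exact_mod_cast hU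
      have hL := rlc_log_bound ρ ε q ℓ n k a hρ.1 hε hα hℓ hq1 h1 h2 h3 hkn han' han
      set Q := Real.log q with hQ
      have hQ0 : 0 < Q := Real.log_pos hq1
      have hexp : (q : ℝ) = Real.exp Q := (Real.exp_log hq0).symm
      have hLm := pow_le_pow_left₀ (by positivity) hL m
      have hmge : 6 * (ℓ : ℝ) / ε ≤ m := Nat.le_ceil _
      have hmε : 6 * (ℓ : ℝ) ≤ m * ε := (div_le_iff₀ hε).1 hmge
      have hfin : (q : ℝ) ^ (n * ℓ) * Real.exp (Q * n * (1 - ε / 2)) ^ m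
          ≤ (2 : ℝ) ^ (-(1 * n : ℝ)) * (q : ℝ) ^ (n * m) := by
        have hl1 : (1 : ℝ) ≤ ℓ := by exact_mod_cast hℓ
        have hnr : (0 : ℝ) ≤ n := Nat.cast_nonneg n
        have h2q : (q : ℝ) ^ (-(1 * n : ℝ)) ≤ (2 : ℝ) ^ (-(1 * n : ℝ)) :=
          Real.rpow_le_rpow_of_nonpos (by norm_num) hq2 (by linarith)
        refine le_trans ?_ (mul_le_mul_of_nonneg_right h2q (by positivity))
        rw [Real.rpow_def_of_pos hq0, ← hQ, hexp, ← Real.exp_nat_mul, ← Real.exp_nat_mul,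
          ← Real.exp_nat_mul, ← Real.exp_add, ← Real.exp_add]
        refine Real.exp_le_exp.2 ?_
        push_cast
        have hnQ : 0 ≤ n * Q := by positivity
        have hh : (ℓ : ℝ) + 1 - m * ε / 2 ≤ 0 := by linarith
        have := mul_nonpos_of_nonneg_of_nonpos hnQ hh
        linarith
      have hqm : (0 : ℝ) < (q : ℝ) ^ (n * m) := by positivity
      refine le_of_mul_le_mul_right ?_ hqm
      calc (Bad.card : ℝ) * (q : ℝ) ^ (n * m) ≤ _ := hU'
        _ = (q : ℝ) ^ (n * ℓ) * (((q : ℝ) ^ k * (n.choose (n - a) : ℝ) *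
              ((ℓ : ℝ) ^ (n - a) * (q : ℝ) ^ a)) ^ m) * (q : ℝ) ^ (n * k) := by
            rw [pow_mul (q : ℝ) k m]; simp only [mul_pow]; ring
        _ ≤ (q : ℝ) ^ (n * ℓ) * (Real.exp (Q * n * (1 - ε / 2)) ^ m) * (q : ℝ) ^ (n * k) := by
            gcongr
        _ ≤ (2 : ℝ) ^ (-(1 * n : ℝ)) * (q : ℝ) ^ (n * m) * (q : ℝ) ^ (n * k) := by
            gcongr
        _ = _ := by ring
  have hsum' : (Nat.card {G // good G} : ℝ) + Bad.card = (q : ℝ) ^ (n * k) := by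
    exact_mod_cast hsum
  rw [cM, Nat.cast_pow, le_div_iff₀ (by positivity)]
  linarith
end
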